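/- Let f_E = f_M + f_C be normalized supermodular, β₁ = max{⌈f_E(X)/|X|⌉ : ∅ ≠ X ⊆ N}, and let N₁ be the smallest subset of N maximizing f_E(X) − (β₁−1)|X|. If z* minimizes a symmetric strictly convex Φ over B_E = B̈_M + B̄_C, then z*_i ≥ β₁ − 1 for all i ∈ N₁, and z*(N₁) = f_E(N₁). -/

import Mathlib

open Finset

/-- The M-convex set of an integer-valued supermodular function. -/
def MSet {N : Type*} [Fintype N] (f : Finset N → ℤ) : Set (N → ℤ) :=
  {x | (∑ i, x i) = f Finset.univ ∧ ∀ X : Finset N, f X ≤ ∑ i ∈ X, x i}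

/-- The base-polyhedron of an integer-valued supermodular function. -/
def basePoly {N : Type*} [Fintype N] (f : Finset N → ℤ) : Set (N → ℝ) :=
  {y | (∑ i, y i) = f Finset.univ ∧ ∀ X : Finset N, (f X : ℝ) ≤ ∑ i ∈ X, y i}

/-- The Minkowski sum `B_E = B̈_M + B̄_C` of possible utility vectors for mixed goods. -/
def BE {N : Type*} [Fintype N] (fM fC : Finset N → ℤ) : Set (N → ℝ) :=
  {z | ∃ x ∈ MSet fM, ∃ y ∈ basePoly fC, z = fun i => (x i : ℝ) + y i}

/-- Discrete sandwich theorem: between a supermodular and a submodular function with values in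
a linearly ordered abelian group there is a modular one. -/
theorem exists_modular_between {G N : Type*} [AddCommGroup G] [LinearOrder G]
    [IsOrderedAddMonoid G] [DecidableEq N] (s : Finset N) :
    ∀ f g : Finset N → G,
      (∀ X ⊆ s, ∀ Y ⊆ s, f X + f Y ≤ f (X ∪ Y) + f (X ∩ Y)) →
      (∀ X ⊆ s, ∀ Y ⊆ s, g (X ∪ Y) + g (X ∩ Y) ≤ g X + g Y) →
      f ∅ = 0 → g ∅ = 0 → (∀ X ⊆ s, f X ≤ g X) →
      ∃ h : N → G, ∀ X ⊆ s, f X ≤ ∑ i ∈ X, h i ∧ ∑ i ∈ X, h i ≤ g X := by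
  induction s using Finset.induction_on with
  | empty =>
    intro f g _ _ hf0 hg0 _
    refine ⟨0, fun X hX => ?_⟩
    rw [Finset.subset_empty.mp hX]
    simp [hf0, hg0]
  | insert e s he ih =>
    intro f g hf hg hf0 hg0 hfg
    have up : ∀ {X}, X ⊆ s → X ⊆ insert e s := fun h => h.trans (Finset.subset_insert _ _)
    have up' : ∀ {X}, X ⊆ s → insert e X ⊆ insert e s := fun h => Finset.insert_subset_insert _ h
    have nm : ∀ {X}, X ⊆ s → e ∉ X := fun h h' => he (h h')
    have uni : ∀ X Y : Finset N, insert e X ∪ Y = insert e (X ∪ Y) := fun X Y =>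
      Finset.insert_union _ _ _
    have uni' : ∀ X Y : Finset N, X ∪ insert e Y = insert e (X ∪ Y) := fun X Y =>
      Finset.union_insert _ _ _
    have uni2 : ∀ X Y : Finset N, insert e X ∪ insert e Y = insert e (X ∪ Y) := fun X Y => by
      simp
    have int1 : ∀ {X Y}, Y ⊆ s → insert e X ∩ Y = X ∩ Y := fun h =>
      Finset.insert_inter_of_notMem (nm h)
    have int2 : ∀ {X Y}, X ⊆ s → X ∩ insert e Y = X ∩ Y := fun h =>
      Finset.inter_insert_of_notMem (nm h)
    have int3 : ∀ X Y : Finset N, insert e X ∩ insert e Y = insert e (X ∩ Y) := fun X Y =>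
      (Finset.insert_inter_distrib _ _ _).symm
    obtain ⟨W, hW, hWmax⟩ := Finset.exists_max_image s.powerset
      (fun X => f (insert e X) - g X) ⟨∅, by simp⟩
    rw [Finset.mem_powerset] at hW
    obtain ⟨c, hc⟩ : ∃ c, c = f (insert e W) - g W := ⟨_, rfl⟩
    have lo : ∀ X ⊆ s, f (insert e X) - c ≤ g X := by
      intro X hX
      have := hWmax X (Finset.mem_powerset.mpr hX)
      rw [hc, sub_le_comm]
      exact this
    have hi : ∀ Y ⊆ s, f Y ≤ g (insert e Y) - c := by
      intro Y hY
      have h1 := hf _ (up' hW) _ (up hY)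
      have h2 := hg _ (up hW) _ (up' hY)
      rw [uni, int1 hY] at h1
      rw [uni', int2 hW] at h2
      have h3 := hfg _ (up' (Finset.union_subset hW hY))
      have h4 := hfg _ (up (Finset.inter_subset_left.trans hW : W ∩ Y ⊆ s))
      have h5 : f (insert e W) + f Y ≤ g W + g (insert e Y) :=
        h1.trans ((add_le_add h3 h4).trans h2)
      rw [hc, le_sub_iff_add_le, ← add_sub_assoc, sub_le_iff_le_add, add_comm (f Y),
        add_comm (g (insert e Y))]
      exact h5
    refine Exists.elim (ih (fun X => max (f X) (f (insert e X) - c))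
      (fun X => min (g X) (g (insert e X) - c)) ?_ ?_ ?_ ?_ ?_) fun h hh => ?_
    · intro X hX Y hY
      have a1 := hf _ (up hX) _ (up hY)
      have a2 := hf _ (up' hX) _ (up hY)
      have a3 := hf _ (up hX) _ (up' hY)
      have a4 := hf _ (up' hX) _ (up' hY)
      rw [uni, int1 hY] at a2
      rw [uni', int2 hX] at a3
      rw [uni2, int3] at a4
      grind
    · intro X hX Y hY
      have a1 := hg _ (up hX) _ (up hY)
      have a2 := hg _ (up' hX) _ (up hY)
      have a3 := hg _ (up hX) _ (up' hY)
      have a4 := hg _ (up' hX) _ (up' hY)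
      rw [uni, int1 hY] at a2
      rw [uni', int2 hX] at a3
      rw [uni2, int3] at a4
      grind
    · have := lo ∅ (by simp)
      rw [hg0] at this
      simpa [hf0] using this
    · have := hi ∅ (by simp)
      rw [hf0] at this
      simpa [hg0] using this
    · intro X hX
      exact max_le (le_min (hfg _ (up hX)) (hi X hX))
        (le_min (lo X hX) (sub_le_sub_right (hfg _ (up' hX)) _))
    · refine ⟨Function.update h e c, fun X hX => ?_⟩
      have key : ∀ Y ⊆ s, ∑ i ∈ Y, Function.update h e c i = ∑ i ∈ Y, h i := fun Y hY =>
        Finset.sum_update_of_notMem (nm hY) _ _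
      by_cases heX : e ∈ X
      · have hs : X.erase e ⊆ s := by
          rw [← Finset.erase_insert he]; exact Finset.erase_subset_erase _ hX
        obtain ⟨h1, h2⟩ := hh _ hs
        rw [← Finset.insert_erase heX, Finset.sum_insert (Finset.notMem_erase _ _), key _ hs,
          Function.update_self]
        exact ⟨sub_le_iff_le_add'.mp ((le_max_right _ _).trans h1),
          le_sub_iff_add_le'.mp (h2.trans (min_le_right _ _))⟩
      · have hs : X ⊆ s := (Finset.subset_insert_iff_of_notMem heX).mp hX
        obtain ⟨h1, h2⟩ := hh _ hs
        rw [key _ hs]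
        exact ⟨(le_max_left _ _).trans h1, h2.trans (min_le_left _ _)⟩

/-- The largest value of a supermodular function on subsets is supermodular. -/
theorem sup_powerset_supermodular {N : Type*} [DecidableEq N] {p : Finset N → ℝ}
    (hp : ∀ X Y, p X + p Y ≤ p (X ∪ Y) + p (X ∩ Y)) (X Y : Finset N) :
    X.powerset.sup' (Finset.powerset_nonempty X) p + Y.powerset.sup' (Finset.powerset_nonempty Y) p
      ≤ (X ∪ Y).powerset.sup' (Finset.powerset_nonempty _) p
        + (X ∩ Y).powerset.sup' (Finset.powerset_nonempty _) p := by
  obtain ⟨U, hU, hU'⟩ := Finset.exists_mem_eq_sup' (Finset.powerset_nonempty X) p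
  obtain ⟨V, hV, hV'⟩ := Finset.exists_mem_eq_sup' (Finset.powerset_nonempty Y) p
  rw [Finset.mem_powerset] at hU hV
  rw [hU', hV']
  exact (hp U V).trans (add_le_add
    (Finset.le_sup' p (Finset.mem_powerset.mpr (Finset.union_subset_union hU hV)))
    (Finset.le_sup' p (Finset.mem_powerset.mpr (Finset.inter_subset_inter hU hV))))

/-- A base polyhedron meets a box as soon as the lower and the upper bounds are separately
compatible with the supermodular function. -/
theorem exists_base_mem_Icc {N : Type*} [Fintype N] [DecidableEq N] {f : Finset N → ℝ}
    (hf : ∀ X Y, f X + f Y ≤ f (X ∪ Y) + f (X ∩ Y)) (hf0 : f ∅ = 0) {a b : N → ℝ} (hab : a ≤ b)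
    (hb : ∀ X, f X ≤ ∑ i ∈ X, b i) (ha : ∀ X, f Xᶜ + ∑ i ∈ X, a i ≤ f univ) :
    ∃ y : N → ℝ, ∑ i, y i = f univ ∧ (∀ X, f X ≤ ∑ i ∈ X, y i) ∧ a ≤ y ∧ y ≤ b := by
  have modular : ∀ (c : N → ℝ) (X Y : Finset N),
      ∑ i ∈ X ∪ Y, c i + ∑ i ∈ X ∩ Y, c i = ∑ i ∈ X, c i + ∑ i ∈ Y, c i := fun c X Y =>
    Finset.sum_union_inter
  set p : Finset N → ℝ := fun X => f X - ∑ i ∈ X, a i with hp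
  set q : Finset N → ℝ := fun X => f Xᶜ - f univ + ∑ i ∈ X, b i with hq
  have hpm : ∀ X Y, p X + p Y ≤ p (X ∪ Y) + p (X ∩ Y) := fun X Y => by
    simp only [hp]; linarith [hf X Y, modular a X Y]
  have hqm : ∀ X Y, q X + q Y ≤ q (X ∪ Y) + q (X ∩ Y) := fun X Y => by
    have := hf Xᶜ Yᶜ
    simp only [hq, Finset.compl_union, Finset.compl_inter]
    linarith [modular b X Y]
  refine Exists.elim (exists_modular_between univ
    (fun X => ∑ i ∈ X, a i + X.powerset.sup' (Finset.powerset_nonempty X) p)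
    (fun X => ∑ i ∈ X, b i - X.powerset.sup' (Finset.powerset_nonempty X) q)
    (fun X _ Y _ => by linarith [sup_powerset_supermodular hpm X Y, modular a X Y])
    (fun X _ Y _ => by linarith [sup_powerset_supermodular hqm X Y, modular b X Y])
    (by simp [hp, hf0]) (by simp [hq]) ?_) fun y hy => ?_
  · intro X _
    obtain ⟨U, hU, hU'⟩ := Finset.exists_mem_eq_sup' (Finset.powerset_nonempty X) p
    obtain ⟨V, hV, hV'⟩ := Finset.exists_mem_eq_sup' (Finset.powerset_nonempty X) q
    rw [Finset.mem_powerset] at hU hV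
    rw [hU', hV']
    simp only [hp, hq]
    have h1 := hf U Vᶜ
    have h2 := hb (U ∩ Vᶜ)
    have h3 := ha (V \ U)
    rw [show (V \ U)ᶜ = U ∪ Vᶜ by ext; simp; tauto] at h3
    have h4 : ∑ i ∈ X \ (U ∪ V), a i ≤ ∑ i ∈ X \ (U ∪ V), b i :=
      Finset.sum_le_sum fun i _ => hab i
    have e1 : ∑ i ∈ X, a i =
        ∑ i ∈ X \ (U ∪ V), a i + (∑ i ∈ V \ U, a i + ∑ i ∈ U, a i) := by
      rw [← Finset.sum_union Finset.sdiff_disjoint, Finset.sdiff_union_self_eq_union,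
        Finset.union_comm V, Finset.sum_sdiff (Finset.union_subset hU hV)]
    have e2 : ∑ i ∈ X, b i =
        ∑ i ∈ X \ (U ∪ V), b i + (∑ i ∈ U ∩ Vᶜ, b i + ∑ i ∈ V, b i) := by
      rw [← Finset.sdiff_eq_inter_compl, ← Finset.sum_union Finset.sdiff_disjoint,
        Finset.sdiff_union_self_eq_union, Finset.sum_sdiff (Finset.union_subset hU hV)]
    linarith
  · have lo : ∀ X Y, Y ⊆ X → ∑ i ∈ X, a i + p Y ≤ ∑ i ∈ X, y i := fun X Y h =>
      le_trans (by gcongr; exact Finset.le_sup' p (Finset.mem_powerset.mpr h))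
        (hy X (subset_univ _)).1
    have hi : ∀ X Y, Y ⊆ X → ∑ i ∈ X, y i ≤ ∑ i ∈ X, b i - q Y := fun X Y h =>
      le_trans (hy X (subset_univ _)).2
        (by gcongr; exact Finset.le_sup' q (Finset.mem_powerset.mpr h))
    have hfy : ∀ X, f X ≤ ∑ i ∈ X, y i := fun X => by
      have := lo X X subset_rfl
      simp only [hp] at this; linarith
    refine ⟨y, le_antisymm ?_ (hfy _), hfy, fun i => ?_, fun i => ?_⟩
    · have := hi univ univ subset_rfl
      simp only [hq, Finset.compl_univ, hf0] at this; linarith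
    · have := lo {i} ∅ (by simp)
      simpa [hp, hf0] using this
    · have := hi {i} ∅ (by simp)
      simpa [hq] using this

/-- Integral vectors of the sum of two integral base polyhedra decompose integrally. -/
theorem exists_base_add_base {N : Type*} [Fintype N] [DecidableEq N] {f g : Finset N → ℤ}
    (hf : ∀ X Y, f X + f Y ≤ f (X ∪ Y) + f (X ∩ Y)) (hf0 : f ∅ = 0)
    (hg : ∀ X Y, g X + g Y ≤ g (X ∪ Y) + g (X ∩ Y)) (hg0 : g ∅ = 0) {w : N → ℤ}
    (hw : w ∈ MSet fun X => f X + g X) :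
    ∃ x ∈ MSet f, ∃ u ∈ MSet g, w = x + u := by
  obtain ⟨hwu, hwX⟩ := hw
  obtain ⟨x, hx⟩ := exists_modular_between univ f (fun X => ∑ i ∈ X, w i - g X)
    (fun X _ Y _ => hf X Y)
    (fun X _ Y _ => by
      have : ∑ i ∈ X ∪ Y, w i + ∑ i ∈ X ∩ Y, w i = ∑ i ∈ X, w i + ∑ i ∈ Y, w i :=
        Finset.sum_union_inter
      linarith [hg X Y])
    hf0 (by simp [hg0]) (fun X _ => by linarith [hwX X])
  have hxu := hx univ subset_rfl
  refine ⟨x, ⟨by linarith, fun X => (hx X (subset_univ _)).1⟩, w - x, ⟨?_, fun X => ?_⟩, by simp⟩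
  · simp only [Pi.sub_apply, Finset.sum_sub_distrib]; linarith
  · simp only [Pi.sub_apply, Finset.sum_sub_distrib]; linarith [(hx X (subset_univ _)).2]

/-- In a lattice of sets, pointwise separation of `A` from `B` gives a separating member. -/
theorem exists_separating {N : Type*} [Fintype N] [DecidableEq N] {P : Finset N → Prop}
    (h0 : P ∅) (h1 : P univ) (hU : ∀ X Y, P X → P Y → P (X ∪ Y))
    (hI : ∀ X Y, P X → P Y → P (X ∩ Y)) {A B : Finset N}
    (hAB : ∀ i ∈ A, ∀ j ∈ B, ∃ X, P X ∧ i ∈ X ∧ j ∉ X) :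
    ∃ X, P X ∧ A ⊆ X ∧ Disjoint X B := by
  choose! T hT using hAB
  refine ⟨A.sup fun i => B.inf (T i), ?_, ?_, ?_⟩
  · refine Finset.sup_induction h0 (fun X hX Y hY => hU X Y hX hY) fun i hi => ?_
    exact Finset.inf_induction h1 (fun X hX Y hY => hI X Y hX hY) fun j hj => (hT i hi j hj).1
  · intro i hi
    have : B.inf (T i) ≤ A.sup fun i => B.inf (T i) :=
      Finset.le_sup (f := fun i => B.inf (T i)) hi
    refine this ?_
    have : ({i} : Finset N) ≤ B.inf (T i) := Finset.le_inf fun j hj => by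
      simpa using (hT i hi j hj).2.1
    exact Finset.singleton_subset_iff.mp this
  · rw [Finset.disjoint_sup_left]
    intro i hi
    rw [Finset.disjoint_right]
    intro j hj hjm
    exact (hT i hi j hj).2.2 ((Finset.inf_le hj : B.inf (T i) ≤ T i j) hjm)

/-- A transfer from a larger to a smaller coordinate that is less than their difference
decreases a symmetric strictly convex function. -/
theorem transfer_lt {N : Type*} [DecidableEq N] {Φ : (N → ℝ) → ℝ}
    (hsym : ∀ (σ : Equiv.Perm N) (z : N → ℝ), Φ (z ∘ σ) = Φ z)
    (hconv : StrictConvexOn ℝ Set.univ Φ) {z : N → ℝ} {i j : N} {δ : ℝ} (hδ : 0 < δ)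
    (hδ' : δ < z i - z j) : Φ (z - Pi.single i δ + Pi.single j δ) < Φ z := by
  have hij : i ≠ j := by rintro rfl; linarith
  have hd : 0 < z i - z j := hδ.trans hδ'
  have hne : z ≠ z ∘ Equiv.swap i j := fun h => by
    have := congrFun h i
    simp at this; linarith
  have := hconv.2 (Set.mem_univ z) (Set.mem_univ (z ∘ Equiv.swap i j)) hne
    (show 0 < 1 - δ / (z i - z j) by rw [sub_pos, div_lt_one hd]; exact hδ')
    (div_pos hδ hd) (sub_add_cancel _ _)
  rw [hsym, ← add_smul, sub_add_cancel, one_smul] at this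
  refine lt_of_eq_of_lt (congrArg Φ (funext fun k => ?_)) this
  by_cases hki : k = i
  · subst hki
    simp [hij]
    field_simp
    ring
  by_cases hkj : k = j
  · subst hkj
    simp [hij.symm]
    field_simp
    ring
  simp [hki, hkj, Equiv.swap_apply_of_ne_of_ne hki hkj]
  ring

/-- Moving a vector towards a constant without changing its sum decreases a symmetric strictly
convex function. -/
theorem lt_of_between_const {N : Type*} [Fintype N] [DecidableEq N] {Φ : (N → ℝ) → ℝ}
    (hsym : ∀ (σ : Equiv.Perm N) (z : N → ℝ), Φ (z ∘ σ) = Φ z)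
    (hconv : StrictConvexOn ℝ Set.univ Φ) (c : ℝ) {z z' : N → ℝ} (hne : z' ≠ z)
    (hsum : ∑ i, z' i = ∑ i, z i) (hlo : ∀ i, min c (z i) ≤ z' i) (hhi : ∀ i, z' i ≤ max c (z i)) :
    Φ z' < Φ z := by
  induction hn : #{k | z' k ≠ z k} using Nat.strong_induction_on generalizing z with
  | _ n ih =>
    obtain ⟨k, hk⟩ := Function.ne_iff.mp hne
    obtain ⟨i, hi⟩ : ∃ i, z' i < z i := by
      by_contra! h
      exact hk ((Finset.sum_eq_sum_iff_of_le fun i _ => h i).mp hsum.symm k (mem_univ k)).symm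
    obtain ⟨j, hj⟩ : ∃ j, z j < z' j := by
      by_contra! h
      exact hk ((Finset.sum_eq_sum_iff_of_le fun i _ => h i).mp hsum k (mem_univ k))
    have hci : c ≤ z' i := by grind
    have hcj : z' j ≤ c := by grind
    have hij : i ≠ j := by rintro rfl; linarith
    obtain ⟨δ, hδ⟩ : ∃ δ, δ = min (z i - z' i) (z' j - z j) := ⟨_, rfl⟩
    have hδ0 : 0 < δ := by grind
    have hlt := transfer_lt hsym hconv (z := z) (i := i) (j := j) hδ0 (by grind)
    set w := z - Pi.single i δ + Pi.single j δ with hw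
    have wi : w i = z i - δ := by simp [hw, hij]
    have wj : w j = z j + δ := by simp [hw, hij.symm]
    have wk : ∀ k, k ≠ i → k ≠ j → w k = z k := fun k h1 h2 => by simp [hw, h1, h2]
    rcases eq_or_ne z' w with rfl | hne'
    · exact hlt
    refine lt_trans (ih _ ?_ hne' ?_ ?_ ?_ rfl) hlt
    · rw [← hn]
      refine Finset.card_lt_card ((Finset.ssubset_iff_of_subset fun k hk => ?_).mpr ?_)
      · simp only [mem_filter, mem_univ, true_and] at hk ⊢
        by_cases h1 : k = i
        · subst h1; exact hi.ne
        by_cases h2 : k = j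
        · subst h2; exact hj.ne'
        rwa [wk k h1 h2] at hk
      · simp only [mem_filter, mem_univ, true_and, not_not]
        rcases min_choice (z i - z' i) (z' j - z j) with h | h
        · exact ⟨i, hi.ne, by rw [wi]; linarith⟩
        · exact ⟨j, hj.ne', by rw [wj]; linarith⟩
    · rw [hsum]; simp [hw, Finset.sum_add_distrib]
    · intro k
      have := hlo k
      by_cases h1 : k = i
      · subst h1; rw [wi]; grind
      by_cases h2 : k = j
      · subst h2; rw [wj]; grind
      rwa [wk k h1 h2]
    · intro k
      have := hhi k
      by_cases h1 : k = i
      · subst h1; rw [wi]; grind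
      by_cases h2 : k = j
      · subst h2; rw [wj]; grind
      rwa [wk k h1 h2]

/-- The tight sets of a vector in a base polyhedron separate two sets as soon as they separate
their points. -/
theorem exists_tight_separating {N : Type*} [Fintype N] [DecidableEq N] {f : Finset N → ℤ}
    (hf : ∀ X Y, f X + f Y ≤ f (X ∪ Y) + f (X ∩ Y)) (hf0 : f ∅ = 0) {y : N → ℝ}
    (hy : y ∈ basePoly f) {A B : Finset N}
    (hAB : ∀ i ∈ A, ∀ j ∈ B, ∃ X, (f X : ℝ) = ∑ k ∈ X, y k ∧ i ∈ X ∧ j ∉ X) :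
    ∃ X, (f X : ℝ) = ∑ k ∈ X, y k ∧ A ⊆ X ∧ Disjoint X B := by
  have key : ∀ X Y, (f X : ℝ) = ∑ k ∈ X, y k → (f Y : ℝ) = ∑ k ∈ Y, y k →
      (f (X ∪ Y) : ℝ) = ∑ k ∈ X ∪ Y, y k ∧ (f (X ∩ Y) : ℝ) = ∑ k ∈ X ∩ Y, y k := by
    intro X Y hX hY
    have h1 : (f X : ℝ) + f Y ≤ f (X ∪ Y) + f (X ∩ Y) := by exact_mod_cast hf X Y
    have h2 : ∑ k ∈ X ∪ Y, y k + ∑ k ∈ X ∩ Y, y k = ∑ k ∈ X, y k + ∑ k ∈ Y, y k :=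
      Finset.sum_union_inter
    have h3 := hy.2 (X ∪ Y)
    have h4 := hy.2 (X ∩ Y)
    constructor <;> linarith
  exact exists_separating (P := fun X => (f X : ℝ) = ∑ k ∈ X, y k) (by simp [hf0]) hy.1.symm
    (fun X Y hX hY => (key X Y hX hY).1) (fun X Y hX hY => (key X Y hX hY).2) hAB

/-- At a minimizer of a symmetric strictly convex function, every superlevel set is separated
from its complement by tight sets of the real summand. -/
theorem exists_tight_of_lt {N : Type*} [Fintype N] [DecidableEq N] {fM fC : Finset N → ℤ}
    {Φ : (N → ℝ) → ℝ} (hsym : ∀ (σ : Equiv.Perm N) (z : N → ℝ), Φ (z ∘ σ) = Φ z)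
    (hconv : StrictConvexOn ℝ Set.univ Φ) {x : N → ℤ} (hx : x ∈ MSet fM) {y : N → ℝ}
    (hy : y ∈ basePoly fC) (hmin : ∀ z ∈ BE fM fC, Φ (fun i => x i + y i) ≤ Φ z) {i j : N}
    (hij : x j + y j < x i + y i) : ∃ X, (fC X : ℝ) = ∑ k ∈ X, y k ∧ i ∈ X ∧ j ∉ X := by
  by_contra! hcon
  have hne : i ≠ j := by rintro rfl; exact lt_irrefl _ hij
  obtain ⟨W, hW, hWmin⟩ := Finset.exists_min_image ({X | i ∈ X ∧ j ∉ X} : Finset (Finset N))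
    (fun X => ∑ k ∈ X, y k - fC X) ⟨{i}, by simp [hne.symm]⟩
  simp only [mem_filter, mem_univ, true_and] at hW hWmin
  obtain ⟨ε, hε⟩ : ∃ ε, ε = min (∑ k ∈ W, y k - fC W) ((x i + y i - (x j + y j)) / 2) := ⟨_, rfl⟩
  have hε0 : 0 < ε := by
    have h1 : (fC W : ℝ) < ∑ k ∈ W, y k :=
      lt_of_le_of_ne (hy.2 W) fun h => hW.2 (hcon W h hW.1)
    rw [hε]
    exact lt_min (by linarith) (by linarith)
  have hεW := hε.trans_le (min_le_left _ _)
  have hεd := hε.trans_le (min_le_right _ _)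
  refine absurd (hmin ((fun k => (x k : ℝ) + y k) - Pi.single i ε + Pi.single j ε) ?_)
    (not_le.mpr (transfer_lt hsym hconv hε0 (by linarith)))
  refine ⟨x, hx, y - Pi.single i ε + Pi.single j ε, ⟨?_, fun X => ?_⟩, ?_⟩
  · simpa [Finset.sum_add_distrib] using hy.1
  · have h1 := hy.2 X
    simp only [Pi.add_apply, Pi.sub_apply, Finset.sum_add_distrib, Finset.sum_sub_distrib,
      Finset.sum_pi_single']
    split_ifs with hi hj hj
    · linarith
    · linarith [hWmin X ⟨hi, hj⟩]
    · linarith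
    · linarith
  · ext k
    simp only [Pi.add_apply, Pi.sub_apply]
    ring

/-- If the integral summand moves one unit from a coordinate above `β` to one below `β`, the real
summand can be adjusted so that the total moves strictly towards the constant `β`. -/
theorem exists_base_towards_const {N : Type*} [Fintype N] [DecidableEq N] {f : Finset N → ℤ}
    (hf : ∀ X Y, f X + f Y ≤ f (X ∪ Y) + f (X ∩ Y)) (hf0 : f ∅ = 0) {y : N → ℝ}
    (hy : y ∈ basePoly f) {x x' u : N → ℤ} {β : ℤ} {A L : Finset N}
    (hA : ∀ k, k ∈ A ↔ (β : ℝ) < x k + y k) (hL : ∀ k, k ∈ L ↔ (x k : ℝ) + y k = β)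
    (htA : (f A : ℝ) = ∑ k ∈ A, y k) (htD : (f (A ∪ L) : ℝ) = ∑ k ∈ A ∪ L, y k)
    {i j : N} (hi : i ∈ A) (hjA : j ∉ A)
    (hx' : ∀ k ∉ L, x' k =
      x k - Pi.single (M := fun _ => ℤ) i 1 k + Pi.single (M := fun _ => ℤ) j 1 k)
    (hu : ∀ k ∈ L, x' k + u k = β) (hu0 : ∀ k ∉ L, u k = 0)
    (hfu : ∀ X, f (A ∪ (X ∩ L)) - f A ≤ ∑ k ∈ X, u k) (hfu' : ∑ k, u k = f (A ∪ L) - f A) :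
    ∃ y' ∈ basePoly f, (∀ k, min (β : ℝ) (x k + y k) ≤ x' k + y' k) ∧
      (∀ k, x' k + y' k ≤ max (β : ℝ) (x k + y k)) ∧
      (fun k => (x' k : ℝ) + y' k) ≠ fun k => (x k : ℝ) + y k := by
  obtain ⟨B, hB⟩ : ∃ B, B = (A ∪ L)ᶜ := ⟨_, rfl⟩
  have hBz : ∀ k ∈ B, (x k : ℝ) + y k < β := by
    intro k hk
    rw [hB, Finset.mem_compl, Finset.mem_union, hA, hL, not_or, not_lt] at hk
    exact lt_of_le_of_ne hk.1 hk.2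
  have hAL : Disjoint A L := Finset.disjoint_left.mpr fun k h1 h2 => by
    rw [hA] at h1; rw [hL] at h2; linarith
  have hALz : ∀ {k}, k ∈ A → k ∉ L := fun h => Finset.disjoint_left.mp hAL h
  have hBL : ∀ {k}, k ∈ B → k ∉ L ∧ k ∉ A := fun h => by
    rw [hB] at h; simp at h; tauto
  have hx'A : ∀ S ⊆ A, ∑ k ∈ S, x' k = ∑ k ∈ S, x k - if i ∈ S then 1 else 0 := by
    intro S hS
    rw [Finset.sum_congr rfl fun k hk => hx' k (hALz (hS hk)), Finset.sum_add_distrib,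
      Finset.sum_sub_distrib, Finset.sum_pi_single', Finset.sum_pi_single',
      if_neg fun h => hjA (hS h), add_zero]
  have hx'B : ∀ S ⊆ B, ∑ k ∈ S, x' k = ∑ k ∈ S, x k + if j ∈ S then 1 else 0 := by
    intro S hS
    rw [Finset.sum_congr rfl fun k hk => hx' k (hBL (hS hk)).1, Finset.sum_add_distrib,
      Finset.sum_sub_distrib, Finset.sum_pi_single', Finset.sum_pi_single',
      if_neg fun h => (hBL (hS h)).2 hi, sub_zero]
  have huL : ∀ X, ∑ k ∈ X, u k = ∑ k ∈ X ∩ L, u k := fun X =>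
    (Finset.sum_subset Finset.inter_subset_left fun k hk hkL => hu0 k fun h =>
      hkL (Finset.mem_inter.mpr ⟨hk, h⟩)).symm
  have huL' : ∀ X, ∑ k ∈ X ∩ L, x' k + ∑ k ∈ X, u k = β * #(X ∩ L) := fun X => by
    rw [huL, ← Finset.sum_add_distrib,
      Finset.sum_congr rfl fun k hk => hu k (Finset.mem_inter.mp hk).2, Finset.sum_const,
      nsmul_eq_mul, mul_comm]
  have split : ∀ (c : N → ℝ) (X : Finset N),
      ∑ k ∈ X, c k = ∑ k ∈ X ∩ A, c k + ∑ k ∈ X ∩ L, c k + ∑ k ∈ X ∩ B, c k := by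
    intro c X
    rw [← Finset.sum_union (hAL.mono Finset.inter_subset_right Finset.inter_subset_right),
      ← Finset.inter_union_distrib_left, hB, ← Finset.sdiff_eq_inter_compl,
      Finset.sum_inter_add_sum_sdiff]
  obtain ⟨F, hF⟩ : ∃ F : Finset N → ℤ, ∀ X, F X =
      f (X ∩ A) + (f (A ∪ (X ∩ L)) - f A) + (f (A ∪ L ∪ X) - f (A ∪ L)) := ⟨_, fun _ => rfl⟩
  have hFs : ∀ X Y, F X + F Y ≤ F (X ∪ Y) + F (X ∩ Y) := by
    intro X Y
    have h1 := hf (X ∩ A) (Y ∩ A)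
    have h2 := hf (A ∪ (X ∩ L)) (A ∪ (Y ∩ L))
    have h3 := hf (A ∪ L ∪ X) (A ∪ L ∪ Y)
    rw [← Finset.union_inter_distrib_right, ← Finset.inter_inter_distrib_right] at h1
    rw [← Finset.union_union_distrib_left, ← Finset.union_inter_distrib_left,
      ← Finset.union_inter_distrib_right, ← Finset.inter_inter_distrib_right] at h2
    rw [← Finset.union_union_distrib_left, ← Finset.union_inter_distrib_left] at h3
    simp only [hF]
    linarith
  have hFf : ∀ X, f X ≤ F X := by
    intro X
    have h1 := hf X A
    have h2 := hf (X ∪ A) (A ∪ L)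
    rw [show X ∪ A ∪ (A ∪ L) = A ∪ L ∪ X by ext; simp; tauto,
      show (X ∪ A) ∩ (A ∪ L) = A ∪ (X ∩ L) by ext; simp; tauto] at h2
    rw [hF]
    linarith
  have hFu : F univ = f univ := by
    rw [hF, Finset.univ_inter, Finset.univ_inter, Finset.union_eq_right.mpr (subset_univ _)]
    ring
  have hycompl : ∀ X, ∑ k ∈ X, y k + ∑ k ∈ Xᶜ, y k = f univ := fun X => by
    rw [Finset.sum_add_sum_compl]; exact hy.1
  have hcast : ∀ {S : Finset N} {c : N → ℤ} {n : ℤ}, ∑ k ∈ S, c k = n →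
      ∑ k ∈ S, (c k : ℝ) = n := fun h => by exact_mod_cast h
  have upper : ∀ X, (F X : ℝ) + ∑ k ∈ X, (x' k : ℝ) ≤ ∑ k ∈ X, max (β : ℝ) (x k + y k) := by
    intro X
    have pA : f (X ∩ A) + ∑ k ∈ X ∩ A, (x' k : ℝ) ≤ ∑ k ∈ X ∩ A, max (β : ℝ) (x k + y k) := by
      have h1 := hy.2 (X ∩ A)
      have h2 := hcast (hx'A (X ∩ A) Finset.inter_subset_right)
      have h3 : ∑ k ∈ X ∩ A, ((x k : ℝ) + y k) ≤ ∑ k ∈ X ∩ A, max (β : ℝ) (x k + y k) :=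
        Finset.sum_le_sum fun k _ => le_max_right _ _
      rw [Finset.sum_add_distrib] at h3
      have h4 : (0 : ℤ) ≤ if i ∈ X ∩ A then 1 else 0 := by split_ifs <;> simp
      have h5 : (0 : ℝ) ≤ ((if i ∈ X ∩ A then 1 else 0 : ℤ) : ℝ) := by exact_mod_cast h4
      rw [h2]; push_cast at h5 ⊢; linarith
    have pL : (f (A ∪ (X ∩ L)) : ℝ) - f A + ∑ k ∈ X ∩ L, (x' k : ℝ) ≤
        ∑ k ∈ X ∩ L, max (β : ℝ) (x k + y k) := by
      have h1 : ∑ k ∈ X ∩ L, (β : ℝ) ≤ ∑ k ∈ X ∩ L, max (β : ℝ) (x k + y k) :=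
        Finset.sum_le_sum fun k _ => le_max_left _ _
      have h2 : f (A ∪ (X ∩ L)) - f A + ∑ k ∈ X ∩ L, x' k ≤ β * #(X ∩ L) := by
        linarith [huL' X, hfu X]
      have h3 : (f (A ∪ (X ∩ L)) : ℝ) - f A + ∑ k ∈ X ∩ L, (x' k : ℝ) ≤ β * #(X ∩ L) := by
        exact_mod_cast h2
      rw [Finset.sum_const, nsmul_eq_mul, mul_comm] at h1
      exact h3.trans h1
    have pB : (f (A ∪ L ∪ X) : ℝ) - f (A ∪ L) + ∑ k ∈ X ∩ B, (x' k : ℝ) ≤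
        ∑ k ∈ X ∩ B, max (β : ℝ) (x k + y k) := by
      rcases (X ∩ B).eq_empty_or_nonempty with hXB | hXB
      · rw [hXB, show A ∪ L ∪ X = A ∪ L from Finset.union_eq_left.mpr <| by
          rwa [hB, ← Finset.sdiff_eq_inter_compl, Finset.sdiff_eq_empty_iff_subset] at hXB]
        simp
      have h0 : ∑ k ∈ A ∪ L ∪ X, y k = ∑ k ∈ A ∪ L, y k + ∑ k ∈ X ∩ B, y k := by
        rw [hB, ← Finset.sdiff_eq_inter_compl, ← Finset.sum_union Finset.disjoint_sdiff,
          Finset.union_sdiff_self_eq_union]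
      have h1 := hy.2 (A ∪ L ∪ X)
      have h2 : ∑ k ∈ X ∩ B, ((x k : ℝ) + y k) < ∑ k ∈ X ∩ B, (β : ℝ) :=
        Finset.sum_lt_sum_of_nonempty hXB fun k hk => hBz k (Finset.mem_inter.mp hk).2
      rw [Finset.sum_add_distrib, Finset.sum_const, nsmul_eq_mul, mul_comm] at h2
      have h3 : f (A ∪ L ∪ X) - f (A ∪ L) + ∑ k ∈ X ∩ B, x k < β * #(X ∩ B) := by
        have : (f (A ∪ L ∪ X) : ℝ) - f (A ∪ L) + ∑ k ∈ X ∩ B, (x k : ℝ) < β * #(X ∩ B) := by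
          linarith
        exact_mod_cast this
      have h4 : f (A ∪ L ∪ X) - f (A ∪ L) + ∑ k ∈ X ∩ B, x' k ≤ β * #(X ∩ B) := by
        rw [hx'B _ Finset.inter_subset_right]
        split_ifs <;> linarith
      have h5 : ∑ k ∈ X ∩ B, (β : ℝ) ≤ ∑ k ∈ X ∩ B, max (β : ℝ) (x k + y k) :=
        Finset.sum_le_sum fun k _ => le_max_left _ _
      rw [Finset.sum_const, nsmul_eq_mul, mul_comm] at h5
      refine le_trans ?_ h5
      exact_mod_cast h4
    rw [split _ X, split _ X, hF]
    push_cast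
    linarith
  have lower : ∀ X, (F Xᶜ : ℝ) + ∑ k ∈ Xᶜ, (x' k : ℝ) + ∑ k ∈ X, min (β : ℝ) (x k + y k) ≤
      F univ + ∑ k, (x' k : ℝ) := by
    intro X
    have pA : f (Xᶜ ∩ A) + ∑ k ∈ X ∩ A, min (β : ℝ) (x k + y k) ≤
        f A + ∑ k ∈ X ∩ A, (x' k : ℝ) := by
      rcases (X ∩ A).eq_empty_or_nonempty with hXA | hXA
      · rw [hXA, show Xᶜ ∩ A = A by ext k; have := Finset.ext_iff.mp hXA k; simp at this ⊢; tauto]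
        simp
      have h0 : ∑ k ∈ A, y k = ∑ k ∈ Xᶜ ∩ A, y k + ∑ k ∈ X ∩ A, y k := by
        rw [Finset.inter_comm, Finset.inter_comm X, ← Finset.sdiff_eq_inter_compl, add_comm,
          Finset.sum_inter_add_sum_sdiff]
      have h1 := hy.2 (Xᶜ ∩ A)
      have h2 : ∑ k ∈ X ∩ A, (β : ℝ) < ∑ k ∈ X ∩ A, ((x k : ℝ) + y k) :=
        Finset.sum_lt_sum_of_nonempty hXA fun k hk => (hA k).mp (Finset.mem_inter.mp hk).2
      rw [Finset.sum_add_distrib, Finset.sum_const, nsmul_eq_mul, mul_comm] at h2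
      have h3 : f (Xᶜ ∩ A) + β * #(X ∩ A) < f A + ∑ k ∈ X ∩ A, x k := by
        have : (f (Xᶜ ∩ A) : ℝ) + β * #(X ∩ A) < f A + ∑ k ∈ X ∩ A, (x k : ℝ) := by
          linarith
        exact_mod_cast this
      have h4 : f (Xᶜ ∩ A) + β * #(X ∩ A) ≤ f A + ∑ k ∈ X ∩ A, x' k := by
        rw [hx'A _ Finset.inter_subset_right]
        split_ifs <;> linarith
      have h5 : ∑ k ∈ X ∩ A, min (β : ℝ) (x k + y k) ≤ ∑ k ∈ X ∩ A, (β : ℝ) :=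
        Finset.sum_le_sum fun k _ => min_le_left _ _
      rw [Finset.sum_const, nsmul_eq_mul, mul_comm] at h5
      refine le_trans (add_le_add_right h5 _) ?_
      exact_mod_cast h4
    have pL : (f (A ∪ (Xᶜ ∩ L)) : ℝ) + ∑ k ∈ X ∩ L, min (β : ℝ) (x k + y k) ≤
        f (A ∪ L) + ∑ k ∈ X ∩ L, (x' k : ℝ) := by
      have h1 : ∑ k ∈ X ∩ L, min (β : ℝ) (x k + y k) ≤ ∑ k ∈ X ∩ L, (β : ℝ) :=
        Finset.sum_le_sum fun k _ => min_le_left _ _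
      have h2 : f (A ∪ (Xᶜ ∩ L)) + β * #(X ∩ L) ≤ f (A ∪ L) + ∑ k ∈ X ∩ L, x' k := by
        linarith [huL' X, hfu Xᶜ, Finset.sum_add_sum_compl X u]
      rw [Finset.sum_const, nsmul_eq_mul, mul_comm] at h1
      refine le_trans (add_le_add_right h1 _) ?_
      exact_mod_cast h2
    have pB : (f (A ∪ L ∪ Xᶜ) : ℝ) + ∑ k ∈ X ∩ B, min (β : ℝ) (x k + y k) ≤
        f univ + ∑ k ∈ X ∩ B, (x' k : ℝ) := by
      have h0 : (A ∪ L ∪ Xᶜ)ᶜ = X ∩ B := by rw [hB]; ext; simp; tauto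
      have h1 := hy.2 (A ∪ L ∪ Xᶜ)
      have h2 := hycompl (A ∪ L ∪ Xᶜ)
      rw [h0] at h2
      have h3 : ∑ k ∈ X ∩ B, min (β : ℝ) (x k + y k) ≤ ∑ k ∈ X ∩ B, ((x k : ℝ) + y k) :=
        Finset.sum_le_sum fun k _ => min_le_right _ _
      rw [Finset.sum_add_distrib] at h3
      have h4 : ∑ k ∈ X ∩ B, x k ≤ ∑ k ∈ X ∩ B, x' k := by
        rw [hx'B _ Finset.inter_subset_right]
        split_ifs <;> linarith
      have h5 : ∑ k ∈ X ∩ B, (x k : ℝ) ≤ ∑ k ∈ X ∩ B, (x' k : ℝ) := by exact_mod_cast h4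
      linarith
    have h1 := Finset.sum_add_sum_compl X fun k => (x' k : ℝ)
    have h2 := split (fun k => (x' k : ℝ)) X
    rw [split _ X, hFu, hF]
    push_cast
    linarith
  obtain ⟨z, hz1, hz2, hz3, hz4⟩ := exists_base_mem_Icc
    (f := fun X => (F X : ℝ) + ∑ k ∈ X, (x' k : ℝ))
    (a := fun k => min (β : ℝ) (x k + y k)) (b := fun k => max (β : ℝ) (x k + y k))
    (fun X Y => by
      have h1 : (F X : ℝ) + F Y ≤ F (X ∪ Y) + F (X ∩ Y) := by exact_mod_cast hFs X Y
      have h2 : ∑ k ∈ X ∪ Y, (x' k : ℝ) + ∑ k ∈ X ∩ Y, (x' k : ℝ) =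
        ∑ k ∈ X, (x' k : ℝ) + ∑ k ∈ Y, (x' k : ℝ) := Finset.sum_union_inter
      linarith)
    (by simp [hF, hf0]) (fun k => min_le_max)
    upper lower
  refine ⟨fun k => z k - x' k, ⟨?_, fun X => ?_⟩, fun k => ?_, fun k => ?_, fun h => ?_⟩
  · rw [Finset.sum_sub_distrib, hz1, hFu]; ring
  · have h1 := hz2 X
    have h2 : (f X : ℝ) ≤ F X := by exact_mod_cast hFf X
    rw [Finset.sum_sub_distrib]; linarith
  · simpa using hz3 k
  · simpa using hz4 k
  · have h1 : ∑ k ∈ A, z k = ∑ k ∈ A, (x k : ℝ) + ∑ k ∈ A, y k := by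
      rw [← Finset.sum_add_distrib]
      exact Finset.sum_congr rfl fun k _ => by simpa using congrFun h k
    have h2 := hz2 Aᶜ
    have h3 : F Aᶜ = f univ - f A := by
      rw [hF, show Aᶜ ∩ A = ∅ by ext; simp,
        Finset.inter_eq_right.mpr fun k h1 => Finset.mem_compl.mpr fun h2 => hALz h2 h1,
        show A ∪ L ∪ Aᶜ = univ by ext; simp; tauto, hf0]
      ring
    have h4 : ∑ k ∈ A, (x' k : ℝ) = ∑ k ∈ A, (x k : ℝ) - 1 := by
      exact_mod_cast (hx'A A subset_rfl).trans (by rw [if_pos hi])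
    have h5 := Finset.sum_add_sum_compl A z
    have h6 := Finset.sum_add_sum_compl A fun k => (x' k : ℝ)
    simp only [h3, Int.cast_sub, hFu] at h2 hz1
    linarith

/-- At a minimizer of a symmetric strictly convex function over the sum of an integral and a real
base polyhedron, for every integer `β` some tight set lies between the strict and the weak
superlevel sets of `β`. -/
theorem exists_tight_between_superlevel {N : Type*} [Fintype N] [DecidableEq N]
    {fM fC : Finset N → ℤ}
    (hM : ∀ X Y, fM X + fM Y ≤ fM (X ∪ Y) + fM (X ∩ Y)) (hM0 : fM ∅ = 0)
    (hC : ∀ X Y, fC X + fC Y ≤ fC (X ∪ Y) + fC (X ∩ Y)) (hC0 : fC ∅ = 0)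
    {Φ : (N → ℝ) → ℝ} (hsym : ∀ (σ : Equiv.Perm N) (z : N → ℝ), Φ (z ∘ σ) = Φ z)
    (hconv : StrictConvexOn ℝ Set.univ Φ) {x : N → ℤ} (hx : x ∈ MSet fM) {y : N → ℝ}
    (hy : y ∈ basePoly fC) (hmin : ∀ z ∈ BE fM fC, Φ (fun i => x i + y i) ≤ Φ z) (β : ℤ) :
    ∃ X, (fM X : ℝ) + fC X = ∑ k ∈ X, ((x k : ℝ) + y k) ∧
      (∀ k, (β : ℝ) < x k + y k → k ∈ X) ∧ ∀ k ∈ X, (β : ℝ) ≤ x k + y k := by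
  obtain ⟨A, hA⟩ : ∃ A : Finset N, ∀ k, k ∈ A ↔ (β : ℝ) < x k + y k :=
    ⟨Finset.univ.filter fun k => (β : ℝ) < x k + y k, by simp⟩
  obtain ⟨L, hL⟩ : ∃ L : Finset N, ∀ k, k ∈ L ↔ (x k : ℝ) + y k = β :=
    ⟨Finset.univ.filter fun k => (x k : ℝ) + y k = β, by simp⟩
  have hAL : Disjoint A L := Finset.disjoint_left.mpr fun k h1 h2 => by
    rw [hA] at h1; rw [hL] at h2; linarith
  have hB : ∀ {k}, k ∉ A ∪ L → (x k : ℝ) + y k < β := by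
    intro k hk
    rw [Finset.mem_union, hA, hL, not_or, not_lt] at hk
    exact lt_of_le_of_ne hk.1 hk.2
  have tight : ∀ S : Finset N, (∀ i ∈ S, ∀ j ∉ S, (x j : ℝ) + y j < x i + y i) →
      (fC S : ℝ) = ∑ k ∈ S, y k := by
    intro S hS
    obtain ⟨X, hX, h1, h2⟩ := exists_tight_separating hC hC0 hy (A := S) (B := Sᶜ)
      fun i hi j hj => exists_tight_of_lt hsym hconv hx hy hmin
        (hS i hi j (Finset.mem_compl.mp hj))
    rwa [Finset.Subset.antisymm (disjoint_compl_right_iff.mp h2) h1] at hX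
  have htA := tight A fun i hi j hj => by
    rw [hA] at hi hj
    exact (not_lt.mp hj).trans_lt hi
  have htD := tight (A ∪ L) fun i hi j hj => by
    refine (hB hj).trans_le ?_
    rw [Finset.mem_union, hA, hL] at hi
    exact hi.elim le_of_lt ge_of_eq
  obtain ⟨g, hg⟩ : ∃ g : Finset N → ℤ, ∀ X, g X = fC (A ∪ (X ∩ L)) - fC A := ⟨_, fun _ => rfl⟩
  have hgs : ∀ X Y, g X + g Y ≤ g (X ∪ Y) + g (X ∩ Y) := by
    intro X Y
    have h := hC (A ∪ (X ∩ L)) (A ∪ (Y ∩ L))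
    rw [← Finset.union_union_distrib_left, ← Finset.union_inter_distrib_left,
      ← Finset.union_inter_distrib_right, ← Finset.inter_inter_distrib_right] at h
    rw [hg, hg, hg, hg]
    linarith
  have hg0 : g ∅ = 0 := by simp [hg]
  have hgu : g univ = fC (A ∪ L) - fC A := by rw [hg, Finset.univ_inter]
  have hgy : ∀ X, (g X : ℝ) ≤ ∑ k ∈ X ∩ L, y k := by
    intro X
    have h := hy.2 (A ∪ (X ∩ L))
    rw [Finset.sum_union (hAL.mono_right Finset.inter_subset_right)] at h
    rw [hg]
    push_cast
    linarith
  have hguy : (g univ : ℝ) = ∑ k ∈ L, y k := by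
    rw [Finset.sum_union hAL] at htD
    rw [hgu]
    push_cast
    linarith
  obtain ⟨w, hwL, hwL'⟩ : ∃ w : N → ℤ, (∀ k ∈ L, w k = β) ∧ ∀ k ∉ L, w k = x k :=
    ⟨fun k => if k ∈ L then β else x k, fun k hk => if_pos hk, fun k hk => if_neg hk⟩
  have hwsum : ∀ X, ∑ k ∈ X, (w k : ℝ) = ∑ k ∈ X, (x k : ℝ) + ∑ k ∈ X ∩ L, y k := by
    intro X
    rw [← Finset.sum_ite_mem, ← Finset.sum_add_distrib]
    refine Finset.sum_congr rfl fun k _ => ?_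
    split_ifs with hk
    · rw [hwL k hk, (hL k).mp hk]
    · rw [hwL' k hk, add_zero]
  have hFs : ∀ X Y, (fM X + g X) + (fM Y + g Y) ≤
      (fM (X ∪ Y) + g (X ∪ Y)) + (fM (X ∩ Y) + g (X ∩ Y)) := fun X Y => by
    linarith [hM X Y, hgs X Y]
  have hxX : ∀ X, (fM X : ℝ) ≤ ∑ k ∈ X, (x k : ℝ) := fun X => by exact_mod_cast hx.2 X
  have hxu : ∑ k, (x k : ℝ) = fM univ := by exact_mod_cast hx.1
  have hw : (fun k => (w k : ℝ)) ∈ basePoly fun X => fM X + g X := by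
    refine ⟨?_, fun X => ?_⟩
    · rw [hwsum, Finset.univ_inter, hxu, ← hguy]
      push_cast
      rfl
    · rw [hwsum]
      push_cast
      exact add_le_add (hxX X) (hgy X)
  obtain ⟨X, hX, hAX, hXB⟩ := exists_tight_separating hFs (by simp [hM0, hg0]) hw
    (A := A) (B := (A ∪ L)ᶜ) <| by
    intro i hi j hj
    rw [Finset.mem_compl] at hj
    by_contra! hcon
    have hjA : j ∉ A := fun h => hj (Finset.mem_union_left _ h)
    have hjL : j ∉ L := fun h => hj (Finset.mem_union_right _ h)
    have hwZ : ∀ X, fM X + g X ≤ ∑ k ∈ X, w k := fun X => by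
      have h := hw.2 X
      dsimp only at h
      exact_mod_cast h
    obtain ⟨x', hx', u, hu, hxu'⟩ := exists_base_add_base hM hM0 hgs hg0
      (w := w - Pi.single i 1 + Pi.single j 1) <| by
      refine ⟨?_, fun X => ?_⟩
      · have h : ∑ k, w k = fM univ + g univ := by
          have h := hw.1
          dsimp only at h
          exact_mod_cast h
        simpa [Finset.sum_add_distrib] using h
      · have h := hwZ X
        simp only [Pi.add_apply, Pi.sub_apply, Finset.sum_add_distrib, Finset.sum_sub_distrib,
          Finset.sum_pi_single']
        split_ifs with hiX hjX hjX
        · linarith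
        · have h' : fM X + g X ≠ ∑ k ∈ X, w k := fun h => hjX (hcon X (by exact_mod_cast h) hiX)
          have := lt_of_le_of_ne h h'
          linarith
        · linarith
        · linarith
    have hiL : i ∉ L := Finset.disjoint_left.mp hAL hi
    have hxu'' : ∀ k, w k - Pi.single (M := fun _ => ℤ) i 1 k +
        Pi.single (M := fun _ => ℤ) j 1 k = x' k + u k := fun k => congrFun hxu' k
    have hu0 : ∀ k ∉ L, u k = 0 := by
      intro k hk
      have h1 := hu.2 {k}
      have h2 := hu.2 {k}ᶜ
      have h3 := Finset.sum_add_sum_compl {k} u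
      rw [hg, Finset.singleton_inter_of_notMem hk, Finset.union_empty, sub_self,
        Finset.sum_singleton] at h1
      rw [hg, Finset.inter_eq_right.mpr fun l hl => by
        rw [Finset.mem_compl, Finset.mem_singleton]
        rintro rfl
        exact hk hl, ← hgu] at h2
      rw [hu.1, Finset.sum_singleton] at h3
      linarith
    obtain ⟨y', hy', hlo, hhi, hne⟩ := exists_base_towards_const hC hC0 hy hA hL htA htD hi hjA
      (x' := x') (u := u)
      (fun k hk => by rw [← hwL' k hk, hxu'' k, hu0 k hk, add_zero])
      (fun k hk => by
        rw [← hxu'' k, hwL k hk, Pi.single_eq_of_ne (by rintro rfl; exact hiL hk),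
          Pi.single_eq_of_ne (by rintro rfl; exact hjL hk)]
        ring)
      hu0 (fun X => (hg X).symm.trans_le (hu.2 X)) (hu.1.trans hgu)
    refine absurd (hmin _ ⟨x', hx', y', hy', rfl⟩)
      (not_le.mpr (lt_of_between_const hsym hconv β hne ?_ hlo hhi))
    have h : ∑ k, (x' k : ℝ) = fM univ := by exact_mod_cast hx'.1
    rw [Finset.sum_add_distrib, Finset.sum_add_distrib, h, hxu, hy.1, hy'.1]
  have hXAL : X ⊆ A ∪ L := disjoint_compl_right_iff.mp hXB
  refine ⟨X, ?_, fun k hk => hAX ((hA k).mpr hk), fun k hk => ?_⟩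
  · have hXe : A ∪ (X ∩ L) = X := by
      rw [Finset.union_inter_distrib_left, Finset.union_eq_right.mpr hAX,
        Finset.inter_eq_left.mpr hXAL]
    have h1 := hgy X
    have h2 := hxX X
    have h3 : ∑ k ∈ X, y k = ∑ k ∈ A, y k + ∑ k ∈ X ∩ L, y k := by
      rw [← Finset.sum_union (hAL.mono_right Finset.inter_subset_right), hXe]
    rw [hwsum] at hX
    have h4 := hg X
    rw [hXe] at h4
    have h5 : (g X : ℝ) = fC X - fC A := by exact_mod_cast h4
    push_cast at hX
    rw [Finset.sum_add_distrib]
    linarith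
  · have h := hXAL hk
    rw [Finset.mem_union, hA, hL] at h
    exact h.elim le_of_lt ge_of_eq

/-- with `β₁ = max{⌈f_E(X)/|X|⌉}` and `N₁` the smallest maximizer of
`f_E(X) − (β₁−1)|X|`, a Φ-minimizer `z*` over `B_E` satisfies `z*_i ≥ β₁ − 1` on `N₁`
and `z*(N₁) = f_E(N₁)`. -/
theorem stmt_11 {N : Type*} [Fintype N] [DecidableEq N] [Nonempty N]
    (fM fC : Finset N → ℤ)
    (hM : ∀ X Y : Finset N, fM X + fM Y ≤ fM (X ∪ Y) + fM (X ∩ Y)) (hM0 : fM ∅ = 0)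
    (hC : ∀ X Y : Finset N, fC X + fC Y ≤ fC (X ∪ Y) + fC (X ∩ Y)) (hC0 : fC ∅ = 0)
    (β₁ : ℤ)
    (hub : ∀ X : Finset N, X.Nonempty → ⌈((fM X + fC X : ℚ)) / (X.card : ℚ)⌉ ≤ β₁)
    (hmax : ∃ X : Finset N, X.Nonempty ∧ β₁ = ⌈((fM X + fC X : ℚ)) / (X.card : ℚ)⌉)
    (N₁ : Finset N)
    (hN₁max : ∀ X : Finset N,
      fM X + fC X - (β₁ - 1) * X.card ≤ fM N₁ + fC N₁ - (β₁ - 1) * N₁.card)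
    (hN₁min : ∀ X : Finset N,
      fM X + fC X - (β₁ - 1) * X.card = fM N₁ + fC N₁ - (β₁ - 1) * N₁.card → N₁ ⊆ X)
    (Φ : (N → ℝ) → ℝ)
    (hsym : ∀ (σ : Equiv.Perm N) (z : N → ℝ), Φ (z ∘ σ) = Φ z)
    (hconv : StrictConvexOn ℝ Set.univ Φ)
    (zs : N → ℝ) (hzs : zs ∈ BE fM fC)
    (hmin : ∀ z ∈ BE fM fC, Φ zs ≤ Φ z) :
    (∀ i ∈ N₁, (β₁ : ℝ) - 1 ≤ zs i) ∧ (∑ i ∈ N₁, zs i = fM N₁ + fC N₁) := by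
  obtain ⟨x, hx, y, hy, rfl⟩ := hzs
  obtain ⟨X, hX, hX1, hX2⟩ :=
    exists_tight_between_superlevel hM hM0 hC hC0 hsym hconv hx hy hmin (β₁ - 1)
  push_cast at hX1 hX2
  have hN : (fM X : ℝ) + fC X - (β₁ - 1) * #X ≤ fM N₁ + fC N₁ - (β₁ - 1) * #N₁ := by
    exact_mod_cast hN₁max X
  have hlow : (fM N₁ : ℝ) + fC N₁ ≤ ∑ i ∈ N₁, ((x i : ℝ) + y i) := by
    have h : (fM N₁ : ℝ) ≤ ∑ i ∈ N₁, (x i : ℝ) := by exact_mod_cast hx.2 N₁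
    rw [Finset.sum_add_distrib]
    exact add_le_add h (hy.2 N₁)
  have hsub : ∀ S : Finset N, ∑ i ∈ S, ((x i : ℝ) + y i - (β₁ - 1)) =
      ∑ i ∈ S, ((x i : ℝ) + y i) - (β₁ - 1) * #S := fun S => by
    rw [Finset.sum_sub_distrib, Finset.sum_const, nsmul_eq_mul, mul_comm]
  have hpos : ∑ i ∈ X, ((x i : ℝ) + y i - (β₁ - 1)) =
      ∑ i, max ((x i : ℝ) + y i - (β₁ - 1)) 0 := by
    rw [← Finset.sum_subset (subset_univ X) fun i _ hi =>
      max_eq_right (sub_nonpos.mpr (not_lt.mp fun h => hi (hX1 i h)))]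
    exact Finset.sum_congr rfl fun i hi => (max_eq_left (sub_nonneg.mpr (hX2 i hi))).symm
  have hle : ∀ i ∈ N₁, (x i : ℝ) + y i - (β₁ - 1) ≤ max ((x i : ℝ) + y i - (β₁ - 1)) 0 :=
    fun i _ => le_max_left _ _
  have h1 := Finset.sum_le_sum hle
  have h2 : ∑ i ∈ N₁, max ((x i : ℝ) + y i - (β₁ - 1)) 0 ≤
      ∑ i, max ((x i : ℝ) + y i - (β₁ - 1)) 0 :=
    Finset.sum_le_sum_of_subset_of_nonneg (subset_univ _) fun i _ _ => le_max_right _ _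
  rw [← hpos, hsub] at h2
  have h3 := hsub N₁
  refine ⟨fun i hi => ?_, by linarith⟩
  have h4 := (Finset.sum_eq_sum_iff_of_le hle).mp (by linarith) i hi
  exact sub_nonneg.mp (h4 ▸ le_max_right _ _)
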